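/- Let ψ ∈ H^{s_0}(𝕋³) with s_0 > 3/2, and let 𝒩_ψ be the multiplication operator (𝒩_ψ v)(x) = ψ(x)v(x) on L²(𝕋³). Let 𝓘_{k,N} be the orthogonal projection onto the span of exponentials e^{i n·x} with n ∈ ℤ³ and N − k ≤ |n|² ≤ N + k. Then for every k > 0 and δ > 0 there exist infinitely many N ∈ ℕ such that ‖𝓘_{k,N}𝒩_ψ𝓘_{k,N}v − ⟨ψ⟩𝓘_{k,N}v‖_{L²} ≤ δ‖v‖_{L²} for all v ∈ L²(𝕋³), where ⟨ψ⟩ = (2π)^{−3}∫_{𝕋³}ψ dx. -/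

import Mathlib

/-- The squared Euclidean norm of a triple of integers. -/
def sqNorm (l : ℤ × ℤ × ℤ) : ℤ := l.1 ^ 2 + l.2.1 ^ 2 + l.2.2 ^ 2

/-- Membership in the spectral band N − k ≤ |l|² ≤ N + k. -/
def inBand (k : ℝ) (N : ℕ) (l : ℤ × ℤ × ℤ) : Prop :=
  (N : ℝ) - k ≤ (sqNorm l : ℝ) ∧ (sqNorm l : ℝ) ≤ (N : ℝ) + k

noncomputable instance (k : ℝ) (N : ℕ) : DecidablePred (inBand k N) := fun _ => instDecidableAnd

/-- For each `d > 0` there are arbitrarily large primes modulo which `-d` is a nonresidue. -/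
theorem exists_prime_gt_jacobiSym_neg_eq_neg_one (d B : ℕ) (hd : 0 < d) :
    ∃ q : ℕ, B < q ∧ q.Prime ∧ jacobiSym (-(d : ℤ)) q = -1 := by
  have hcop : (4 * d - 1).Coprime (4 * d) := by
    have h := Nat.coprime_self_add_right (m := 4 * d - 1) (n := 1)
    rw [Nat.sub_add_cancel (by lia)] at h
    exact h.2 (Nat.coprime_one_right _)
  obtain ⟨q, hqB, hq, hqm⟩ :=
    Nat.forall_exists_prime_gt_and_modEq B (q := 4 * d) (a := 4 * d - 1) (by lia) hcop
  have hmod : q % (4 * d) = 4 * d - 1 := by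
    rw [hqm]
    exact Nat.mod_eq_of_lt (by lia)
  have hodd' : Odd (4 * d - 1) := ⟨2 * d - 1, by lia⟩
  have hmod4 : q % 4 = 3 := by
    have h : q % (4 * d) % 4 = q % 4 := Nat.mod_mul_right_mod q 4 d
    lia
  have hodd : Odd q := Nat.odd_iff.2 (by lia)
  refine ⟨q, hqB, hq, ?_⟩
  have hd1 : jacobiSym (d : ℤ) (4 * d - 1) = 1 := by
    have h4 : jacobiSym (2 ^ 2 : ℤ) (4 * d - 1) = 1 := by
      refine jacobiSym.sq_one' ?_
      exact Int.isCoprime_iff_gcd_eq_one.1 (Nat.isCoprime_iff_coprime.2 (Nat.coprime_two_left.2 hodd'))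
    have h4d : jacobiSym (2 ^ 2 * (d : ℤ)) (4 * d - 1) = 1 := by
      rw [← jacobiSym.one_left (4 * d - 1)]
      refine jacobiSym.mod_left' ?_
      rw [Nat.cast_sub (by lia)]
      push_cast
      exact Int.emod_eq_emod_iff_emod_sub_eq_zero.2
        (Int.emod_eq_zero_of_dvd ⟨1, by ring⟩)
    rw [jacobiSym.mul_left, h4, one_mul] at h4d
    exact h4d
  rw [jacobiSym.neg _ hodd, jacobiSym.mod_right _ hodd, Int.natAbs_natCast, hmod, hd1, mul_one,
    ZMod.χ₄_nat_three_mod_four hmod4]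

/-- Let `w` be orthogonal to `j = (a, b, c)`. If `-|j|²` is a nonresidue modulo a prime `q > |j|²`
and `q ∣ |w|²`, then `q² ∣ |w|²`. -/
theorem sq_dvd_sqNorm_of_dvd_of_fst_ne_zero {q : ℕ} [hq : Fact q.Prime] {a b c x y z : ℤ}
    (ha : a ≠ 0) (hlt : sqNorm (a, b, c) < q) (hj : jacobiSym (-sqNorm (a, b, c)) q = -1)
    (horth : a * x + b * y + c * z = 0) (hdvd : (q : ℤ) ∣ sqNorm (x, y, z)) :
    (q : ℤ) ^ 2 ∣ sqNorm (x, y, z) := by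
  have hqp : Prime (q : ℤ) := Nat.prime_iff_prime_int.1 hq.out
  simp only [sqNorm] at *
  have ha2 : 0 < a ^ 2 := by positivity
  have hx : a * x = -(b * y + c * z) := by linarith
  have key : ((a ^ 2 + b ^ 2) * a ^ 2) * (x ^ 2 + y ^ 2 + z ^ 2) =
      ((a ^ 2 + b ^ 2) * y + b * c * z) ^ 2 - (-(a ^ 2 + b ^ 2 + c ^ 2)) * (a * z) ^ 2 := by
    have : a ^ 2 * x ^ 2 = (b * y + c * z) ^ 2 := by rw [← mul_pow, hx, neg_sq]
    linear_combination (a ^ 2 + b ^ 2) * this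
  obtain ⟨h1, h2⟩ := jacobiSym.prime_dvd_of_eq_neg_one hj (key ▸ hdvd.mul_left _)
  have h3 : (q : ℤ) ^ 2 ∣ ((a ^ 2 + b ^ 2) * a ^ 2) * (x ^ 2 + y ^ 2 + z ^ 2) := by
    rw [key]
    exact dvd_sub (pow_dvd_pow_of_dvd h1 2) ((pow_dvd_pow_of_dvd h2 2).mul_left _)
  refine IsCoprime.dvd_of_dvd_mul_left (IsCoprime.pow_left ?_) h3
  refine (hqp.coprime_iff_not_dvd).2 fun h => ?_
  rcases hqp.dvd_or_dvd h with h | h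
  · have := Int.le_of_dvd (by positivity) h
    nlinarith [sq_nonneg c]
  · have := Int.le_of_dvd ha2 h
    nlinarith [sq_nonneg c, sq_nonneg b]

theorem sq_dvd_sqNorm_of_dvd {q : ℕ} [Fact q.Prime] {a b c x y z : ℤ}
    (h0 : 0 < sqNorm (a, b, c)) (hlt : sqNorm (a, b, c) < q)
    (hj : jacobiSym (-sqNorm (a, b, c)) q = -1)
    (horth : a * x + b * y + c * z = 0) (hdvd : (q : ℤ) ∣ sqNorm (x, y, z)) :
    (q : ℤ) ^ 2 ∣ sqNorm (x, y, z) := by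
  have hrot : ∀ u v w : ℤ, sqNorm (u, v, w) = sqNorm (v, w, u) := fun u v w => by
    simp only [sqNorm]; ring
  rcases eq_or_ne a 0 with ha | ha
  · rw [hrot] at h0 hlt hj hdvd ⊢
    rcases eq_or_ne b 0 with hb | hb
    · rw [hrot] at h0 hlt hj hdvd ⊢
      have hc : c ≠ 0 := by
        rintro rfl
        simp [sqNorm, ha, hb] at h0
      exact sq_dvd_sqNorm_of_dvd_of_fst_ne_zero hc hlt hj (by linarith) hdvd
    · exact sq_dvd_sqNorm_of_dvd_of_fst_ne_zero hb hlt hj (by linarith) hdvd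
  · exact sq_dvd_sqNorm_of_dvd_of_fst_ne_zero ha hlt hj horth hdvd

/-- Finitely many conditions, each of which holds on a residue class to some modulus that can be
chosen coprime to any given number, hold simultaneously on a residue class. -/
theorem exists_forall_of_forall_exists_coprime_modulus {ι : Type*} (P : ι → ℤ → Prop)
    (s : Finset ι)
    (h : ∀ i ∈ s, ∀ Q : ℤ, 0 < Q → ∃ q r : ℤ, 0 < q ∧ IsCoprime Q q ∧ ∀ N, q ∣ N - r → P i N) :
    ∃ Q a : ℤ, 0 < Q ∧ ∀ N, Q ∣ N - a → ∀ i ∈ s, P i N := by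
  classical
  induction s using Finset.induction_on with
  | empty => exact ⟨1, 0, one_pos, by simp⟩
  | insert i s _ ih =>
    obtain ⟨Q, a, hQ, hs⟩ := ih fun j hj => h j (Finset.mem_insert_of_mem hj)
    obtain ⟨q, r, hq, ⟨u, v, huv⟩, hi⟩ := h i (Finset.mem_insert_self _ _) Q hQ
    refine ⟨Q * q, a * (v * q) + r * (u * Q), mul_pos hQ hq, fun N hN j hj => ?_⟩
    obtain ⟨t, ht⟩ := hN
    rcases Finset.mem_insert.1 hj with rfl | hj
    · exact hi N ⟨Q * t + a * v - r * v, by linear_combination ht + r * huv⟩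
    · exact hs N ⟨q * t - a * u + r * u, by linear_combination ht + a * huv⟩ j hj

/-- The residue class on which `d (N + t) - c²` is divisible by a suitable prime exactly once
contains no `N` with a lattice point `l` satisfying `l · j = c`, `|j|² = d` and `|l|² = N + t`. -/
theorem exists_modulus_sqNorm_ne (t d c : ℤ) (hd : 0 < d) (Q : ℤ) (hQ : 0 < Q) :
    ∃ q r : ℤ, 0 < q ∧ IsCoprime Q q ∧ ∀ N, q ∣ N - r → ∀ j l : ℤ × ℤ × ℤ, sqNorm j = d →
      j.1 * l.1 + j.2.1 * l.2.1 + j.2.2 * l.2.2 = c → sqNorm l ≠ N + t := by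
  lift d to ℕ using hd.le
  lift Q to ℕ using hQ.le
  obtain ⟨p, hpB, hp, hpj⟩ := exists_prime_gt_jacobiSym_neg_eq_neg_one d (Q + d) (by lia)
  have : Fact p.Prime := ⟨hp⟩
  have hcop : ∀ n : ℕ, 0 < n → n < p → IsCoprime (n : ℤ) ((p : ℤ) ^ 2) := fun n h0 hn =>
    (Nat.isCoprime_iff_coprime.2 (Nat.coprime_of_lt_prime h0.ne' hn hp).symm).pow_right
  obtain ⟨u, v, huv⟩ := hcop d (by lia) (by lia)
  have hp0 : (0 : ℤ) < p := by exact_mod_cast hp.pos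
  refine ⟨(p : ℤ) ^ 2, u * (c ^ 2 + p) - t, by positivity, hcop Q (by lia) (by lia), ?_⟩
  rintro N ⟨e, he⟩ ⟨j₁, j₂, j₃⟩ ⟨x, y, z⟩ hj hc hl
  have hw : sqNorm (j₂ * z - j₃ * y, j₃ * x - j₁ * z, j₁ * y - j₂ * x) =
      p + p ^ 2 * (d * e - v * (c ^ 2 + p)) := by
    have h1 : sqNorm (j₂ * z - j₃ * y, j₃ * x - j₁ * z, j₁ * y - j₂ * x) =
        sqNorm (j₁, j₂, j₃) * sqNorm (x, y, z) - (j₁ * x + j₂ * y + j₃ * z) ^ 2 := by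
      simp only [sqNorm]; ring
    simp only at hc
    rw [h1, hj, hl, hc]
    linear_combination (d : ℤ) * he + (c ^ 2 + p) * huv
  have hsq := sq_dvd_sqNorm_of_dvd (q := p) (a := j₁) (b := j₂) (c := j₃)
    (x := j₂ * z - j₃ * y) (y := j₃ * x - j₁ * z) (z := j₁ * y - j₂ * x)
    (by rw [hj]; lia) (by rw [hj]; lia) (by rw [hj]; exact hpj) (by ring)
    (by rw [hw]; exact ⟨1 + p * (d * e - v * (c ^ 2 + p)), by ring⟩)
  rw [hw, Int.dvd_add_left (dvd_mul_right _ _)] at hsq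
  have h1 := Int.le_of_dvd hp0 hsq
  have h2 : (1 : ℤ) < p := by exact_mod_cast hp.one_lt
  nlinarith

theorem sqNorm_nonneg (l : ℤ × ℤ × ℤ) : 0 ≤ sqNorm l := by
  unfold sqNorm; positivity

/-- For every finite set `F` of differences there are infinitely many spectral bands in which no two
distinct points differ by an element of `F`. -/
theorem infinite_setOf_band_sparse (k : ℝ) (F : Finset (ℤ × ℤ × ℤ)) :
    Set.Infinite {N : ℕ | ∀ m l, inBand k N m → inBand k N l → m ≠ l → m - l ∉ F} := by
  obtain ⟨K, hK⟩ : ∃ K : ℤ, k ≤ K := ⟨⌈k⌉, Int.le_ceil k⟩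
  obtain ⟨D, hD⟩ : ∃ D : ℤ, ∀ j ∈ F, sqNorm j ≤ D := by
    obtain ⟨D, hD⟩ := (F.image sqNorm).bddAbove
    exact ⟨D, fun j hj => hD (by simpa using ⟨_, _, _, hj, rfl⟩)⟩
  obtain ⟨Q, a, hQ, h⟩ := exists_forall_of_forall_exists_coprime_modulus
    (fun (i : ℤ × ℤ × ℤ) N => ∀ j l : ℤ × ℤ × ℤ, sqNorm j = i.2.1 →
      j.1 * l.1 + j.2.1 * l.2.1 + j.2.2 * l.2.2 = i.2.2 → sqNorm l ≠ N + i.1)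
    (Finset.Icc (-K) K ×ˢ Finset.Icc 1 D ×ˢ Finset.Icc (-(2 * K + D)) (2 * K + D))
    (by
      rintro ⟨t, d, c⟩ hi Q hQ
      simp only [Finset.mem_product, Finset.mem_Icc] at hi
      exact exists_modulus_sqNorm_ne t d c (by lia) Q hQ)
  refine Set.infinite_of_forall_exists_gt fun B => ?_
  have hpos : (B : ℤ) < a + Q * (|a| + B + 1) := by
    have := neg_abs_le a
    nlinarith [abs_nonneg a]
  refine ⟨(a + Q * (|a| + B + 1)).toNat, ?_, by lia⟩
  have hN : (((a + Q * (|a| + B + 1)).toNat : ℕ) : ℤ) = a + Q * (|a| + B + 1) := by lia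
  generalize (a + Q * (|a| + B + 1)).toNat = N at hN
  rintro ⟨m₁, m₂, m₃⟩ ⟨l₁, l₂, l₃⟩ ⟨hm1, hm2⟩ ⟨hl1, hl2⟩ hml hF
  have hband : ∀ s : ℤ, (N : ℝ) - k ≤ s → (s : ℝ) ≤ N + k → -K ≤ s - N ∧ s - N ≤ K := by
    intro s h1 h2
    constructor <;> rify <;> linarith
  obtain ⟨hm1, hm2⟩ := hband _ hm1 hm2
  obtain ⟨hl1, hl2⟩ := hband _ hl1 hl2
  have hjD := hD _ hF
  have hexp : sqNorm (m₁, m₂, m₃) = sqNorm (l₁, l₂, l₃) +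
      2 * ((m₁ - l₁) * l₁ + (m₂ - l₂) * l₂ + (m₃ - l₃) * l₃) +
      sqNorm ((m₁, m₂, m₃) - (l₁, l₂, l₃)) := by
    simp only [sqNorm, Prod.mk_sub_mk]; ring
  have hj0 : 0 < sqNorm ((m₁, m₂, m₃) - (l₁, l₂, l₃)) := by
    refine (sqNorm_nonneg _).lt_of_ne' fun h0 => hml ?_
    simp only [sqNorm, Prod.mk_sub_mk] at h0
    have n1 := sq_nonneg (m₁ - l₁)
    have n2 := sq_nonneg (m₂ - l₂)
    have n3 := sq_nonneg (m₃ - l₃)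
    have e1 : (m₁ - l₁) ^ 2 = 0 := by linarith
    have e2 : (m₂ - l₂) ^ 2 = 0 := by linarith
    have e3 : (m₃ - l₃) ^ 2 = 0 := by linarith
    rw [sq_eq_zero_iff, sub_eq_zero] at e1 e2 e3
    rw [e1, e2, e3]
  refine h N ⟨|a| + B + 1, by linarith⟩
    (sqNorm (l₁, l₂, l₃) - N, sqNorm ((m₁, m₂, m₃) - (l₁, l₂, l₃)),
      (m₁ - l₁) * l₁ + (m₂ - l₂) * l₂ + (m₃ - l₃) * l₃) ?_
    ((m₁, m₂, m₃) - (l₁, l₂, l₃)) (l₁, l₂, l₃) rfl rfl (by ring)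
  simp only [Finset.mem_product, Finset.mem_Icc]
  lia

theorem summable_one_add_sq_rpow_neg {b : ℝ} (hb : 1 < 2 * b) :
    Summable fun n : ℤ => (1 + (n : ℝ) ^ 2) ^ (-b) := by
  refine Summable.of_norm_bounded_eventually (Real.summable_abs_int_rpow hb) ?_
  filter_upwards [(Set.finite_singleton (0 : ℤ)).compl_mem_cofinite] with n hn
  have hn : (0 : ℝ) < |(n : ℝ)| := by simpa using hn
  rw [Real.norm_of_nonneg (by positivity), show -(2 * b) = 2 * -b by ring, Real.rpow_mul hn.le]
  refine Real.rpow_le_rpow_of_nonpos (by positivity) ?_ (by linarith)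
  rw [Real.rpow_two, sq_abs]
  linarith

theorem summable_one_add_sqNorm_rpow_neg {s : ℝ} (hs : 3 / 2 < s) :
    Summable fun l : ℤ × ℤ × ℤ => (1 + (sqNorm l : ℝ)) ^ (-s) := by
  have h1 := summable_one_add_sq_rpow_neg (b := s / 3) (by linarith)
  have h3 := h1.mul_of_nonneg (h1.mul_of_nonneg h1 (fun _ => by positivity)
    (fun _ => by positivity)) (fun _ => by positivity) (fun _ => by positivity)
  refine h3.of_nonneg_of_le (fun l => ?_) fun l => ?_
  · have := sqNorm_nonneg l
    positivity
  obtain ⟨x, y, z⟩ := l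
  have hx := sq_nonneg (x : ℝ)
  have hy := sq_nonneg (y : ℝ)
  have hz := sq_nonneg (z : ℝ)
  have hS : (1 + (sqNorm (x, y, z) : ℝ)) = 1 + (x : ℝ) ^ 2 + (y : ℝ) ^ 2 + (z : ℝ) ^ 2 := by
    simp only [sqNorm]; push_cast; ring
  simp only
  rw [hS, show -s = -(s / 3) + (-(s / 3) + -(s / 3)) by ring, Real.rpow_add (by positivity),
    Real.rpow_add (by positivity)]
  gcongr ?_ * (?_ * ?_) <;>
    exact Real.rpow_le_rpow_of_nonpos (by positivity) (by linarith) (by linarith)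

/-- Sobolev embedding in Fourier variables: `H^s(𝕋³)` for `s > 3/2` has summable coefficients. -/
theorem summable_norm_of_summable_sobolev {s : ℝ} (hs : 3 / 2 < s) {p : ℤ × ℤ × ℤ → ℂ}
    (hp : Summable fun l => (1 + (sqNorm l : ℝ)) ^ s * ‖p l‖ ^ 2) :
    Summable fun l => ‖p l‖ := by
  refine (hp.add (summable_one_add_sqNorm_rpow_neg hs)).of_nonneg_of_le
    (fun _ => norm_nonneg _) fun l => ?_
  have h0 : (0 : ℝ) < 1 + (sqNorm l : ℝ) := by
    have : (0 : ℝ) ≤ sqNorm l := by exact_mod_cast sqNorm_nonneg l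
    linarith
  have hA : 0 < (1 + (sqNorm l : ℝ)) ^ s := Real.rpow_pos_of_pos h0 _
  rw [Real.rpow_neg h0.le]
  generalize (1 + (sqNorm l : ℝ)) ^ s = A at hA
  have : A * ‖p l‖ ^ 2 + A⁻¹ - ‖p l‖ = A⁻¹ * ((A * ‖p l‖ - 1 / 2) ^ 2 + 3 / 4) := by
    field_simp; ring
  have : 0 ≤ A⁻¹ * ((A * ‖p l‖ - 1 / 2) ^ 2 + 3 / 4) := by positivity
  linarith

theorem finite_setOf_inBand (k : ℝ) (N : ℕ) : {l | inBand k N l}.Finite := by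
  obtain ⟨R, hR⟩ : ∃ R : ℤ, (N : ℝ) + k ≤ R := ⟨⌈_⌉, Int.le_ceil _⟩
  refine ((Set.finite_Icc (-R) R).prod
    ((Set.finite_Icc (-R) R).prod (Set.finite_Icc (-R) R))).subset ?_
  rintro ⟨x, y, z⟩ ⟨-, h⟩
  have h : x ^ 2 + y ^ 2 + z ^ 2 ≤ R := by exact_mod_cast h.trans hR
  have habs : ∀ n : ℤ, n ^ 2 ≤ R → -R ≤ n ∧ n ≤ R := fun n hn => by
    constructor <;> nlinarith [sq_nonneg (n - 1), sq_nonneg (n + 1)]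
  exact ⟨habs x (by nlinarith), habs y (by nlinarith), habs z (by nlinarith)⟩

/-- **Schur's test** for a finite matrix. -/
theorem sum_norm_sum_mul_sq_le {ι : Type*} (s : Finset ι) (a : ι → ι → ℂ) (v : ι → ℂ) {δ : ℝ}
    (hδ : 0 ≤ δ) (hrow : ∀ m ∈ s, ∑ l ∈ s, ‖a m l‖ ≤ δ) (hcol : ∀ l ∈ s, ∑ m ∈ s, ‖a m l‖ ≤ δ) :
    ∑ m ∈ s, ‖∑ l ∈ s, a m l * v l‖ ^ 2 ≤ δ ^ 2 * ∑ l ∈ s, ‖v l‖ ^ 2 := by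
  calc ∑ m ∈ s, ‖∑ l ∈ s, a m l * v l‖ ^ 2
      ≤ ∑ m ∈ s, δ * ∑ l ∈ s, ‖a m l‖ * ‖v l‖ ^ 2 := by
        refine Finset.sum_le_sum fun m hm => ?_
        calc ‖∑ l ∈ s, a m l * v l‖ ^ 2 ≤ (∑ l ∈ s, ‖a m l‖ * ‖v l‖) ^ 2 := by
              gcongr
              exact norm_sum_le_of_le s fun l _ => (norm_mul _ _).le
          _ ≤ (∑ l ∈ s, ‖a m l‖) * ∑ l ∈ s, ‖a m l‖ * ‖v l‖ ^ 2 :=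
              Finset.sum_sq_le_sum_mul_sum_of_sq_le_mul s (fun _ _ => by positivity)
                (fun _ _ => by positivity) fun l _ => le_of_eq (by ring)
          _ ≤ δ * ∑ l ∈ s, ‖a m l‖ * ‖v l‖ ^ 2 := by
              gcongr
              exact hrow m hm
    _ = δ * ∑ l ∈ s, (∑ m ∈ s, ‖a m l‖) * ‖v l‖ ^ 2 := by
        rw [← Finset.mul_sum, Finset.sum_comm]
        simp_rw [Finset.sum_mul]
    _ ≤ δ * ∑ l ∈ s, δ * ‖v l‖ ^ 2 := by
        gcongr with l hl
        exact hcol l hl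
    _ = δ ^ 2 * ∑ l ∈ s, ‖v l‖ ^ 2 := by
        rw [← Finset.mul_sum]; ring

/-- Spatial averaging property for multiplication operators (Proposition 5.2), written in
Fourier variables on 𝕋³ = (−π,π)³: ψ has Fourier coefficients p ∈ H^{s₀}, s₀ > 3/2;
multiplication by ψ is convolution with p; 𝓘_{k,N} is the projection onto the modes with
N − k ≤ |n|² ≤ N + k, and ⟨ψ⟩ = p 0. For every k > 0 and δ > 0 there are infinitely many
N with ‖𝓘_{k,N} 𝒩_ψ 𝓘_{k,N} v − ⟨ψ⟩ 𝓘_{k,N} v‖_{L²} ≤ δ ‖v‖_{L²} for all v ∈ L². -/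
theorem stmt12 (s₀ : ℝ) (hs₀ : 3 / 2 < s₀) (p : ℤ × ℤ × ℤ → ℂ)
    (hp : Summable fun l => (1 + (sqNorm l : ℝ)) ^ s₀ * ‖p l‖ ^ 2)
    (k δ : ℝ) (hk : 0 < k) (hδ : 0 < δ) :
    Set.Infinite {N : ℕ | ∀ v : ℤ × ℤ × ℤ → ℂ, Summable (fun l => ‖v l‖ ^ 2) →
      (∑' m : ℤ × ℤ × ℤ,
          ‖(if inBand k N m then
              (∑' l : ℤ × ℤ × ℤ, p (m - l) * (if inBand k N l then v l else 0)) - p 0 * v m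
            else 0)‖ ^ 2)
        ≤ δ ^ 2 * ∑' l : ℤ × ℤ × ℤ, ‖v l‖ ^ 2} := by
  have hp1 := summable_norm_of_summable_sobolev hs₀ hp
  obtain ⟨F, hF⟩ := summable_iff_vanishing_norm.1 hp1 δ hδ
  refine (infinite_setOf_band_sparse k F).mono fun N hN v hv => ?_
  classical
  set s := (finite_setOf_inBand k N).toFinset with hs
  have hmem : ∀ l, l ∈ s ↔ inBand k N l := fun l => by simp [hs]
  let a : ℤ × ℤ × ℤ → ℤ × ℤ × ℤ → ℂ := fun m l => if m = l then 0 else p (m - l)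
  have hsum : ∀ m ∈ s, (∑' l : ℤ × ℤ × ℤ, p (m - l) * (if inBand k N l then v l else 0)) -
      p 0 * v m = ∑ l ∈ s, a m l * v l := by
    intro m hm
    rw [tsum_eq_sum (s := s) fun l hl => by simp [mt (hmem l).2 hl], sub_eq_iff_eq_add,
      ← Finset.add_sum_erase s _ hm, ← Finset.add_sum_erase s (fun l => a m l * v l) hm]
    have : ∑ l ∈ s.erase m, p (m - l) * (if inBand k N l then v l else 0) =
        ∑ l ∈ s.erase m, a m l * v l := by
      refine Finset.sum_congr rfl fun l hl => ?_
      have := Finset.mem_erase.1 hl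
      simp [a, this.1.symm, (hmem l).1 this.2]
    rw [this]
    simp [a, (hmem m).1 hm]
    ring
  have htail : ∀ (f : ℤ × ℤ × ℤ → ℤ × ℤ × ℤ) (t : Finset (ℤ × ℤ × ℤ)), Function.Injective f →
      (∀ l ∈ t, f l ∉ F) → ∑ l ∈ t, ‖p (f l)‖ ≤ δ := by
    intro f t hf ht
    have h := hF (t.image f) (Finset.disjoint_left.2 fun x hx => by
      obtain ⟨l, hl, rfl⟩ := Finset.mem_image.1 hx
      exact ht l hl)
    rw [Finset.sum_image hf.injOn] at h
    exact (le_abs_self _).trans h.le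
  have hrow : ∀ m ∈ s, ∑ l ∈ s, ‖a m l‖ ≤ δ := fun m hm => by
    rw [← Finset.add_sum_erase s _ hm]
    have := htail (fun l => m - l) (s.erase m) (sub_right_injective) fun l hl =>
      hN m l ((hmem m).1 hm) ((hmem l).1 (Finset.mem_of_mem_erase hl))
        (Finset.ne_of_mem_erase hl).symm
    refine le_trans (le_of_eq ?_) this
    simp only [a, if_pos, norm_zero, zero_add]
    exact Finset.sum_congr rfl fun l hl => by rw [if_neg (Finset.ne_of_mem_erase hl).symm]
  have hcol : ∀ l ∈ s, ∑ m ∈ s, ‖a m l‖ ≤ δ := fun l hl => by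
    rw [← Finset.add_sum_erase s _ hl]
    have := htail (fun m => m - l) (s.erase l) (sub_left_injective) fun m hm =>
      hN m l ((hmem m).1 (Finset.mem_of_mem_erase hm)) ((hmem l).1 hl) (Finset.ne_of_mem_erase hm)
    refine le_trans (le_of_eq ?_) this
    simp only [a, if_pos, norm_zero, zero_add]
    exact Finset.sum_congr rfl fun m hm => by rw [if_neg (Finset.ne_of_mem_erase hm)]
  rw [tsum_eq_sum (s := s) fun m hm => by simp [mt (hmem m).2 hm]]
  calc _ = ∑ m ∈ s, ‖∑ l ∈ s, a m l * v l‖ ^ 2 :=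
        Finset.sum_congr rfl fun m hm => by rw [if_pos ((hmem m).1 hm), hsum m hm]
    _ ≤ δ ^ 2 * ∑ l ∈ s, ‖v l‖ ^ 2 := sum_norm_sum_mul_sq_le s a v hδ.le hrow hcol
    _ ≤ _ := by
        gcongr
        exact hv.sum_le_tsum s fun _ _ => by positivity
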